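/- arXiv:0712.2469 — 2 statements merged into one kernel-verified Lean document; each statement's English description precedes it below -/
import Mathlib

section
/- Let 0 < r_j ≤ r_k and let x be a point of the Euclidean plane with ‖x‖ = h, where h > 0 and r_k − r_j ≤ h ≤ r_k + r_j. Then the area of the intersection of the two closed disks B̄(0, r_k) and B̄(x, r_j) equals φ₁·r_j² + θ₁·r_k² − h·r_j·sin φ₁, where φ₁ = arccos((h² + r_j² − r_k²)/(2·h·r_j)) and θ₁ = arccos((h² + r_k² − r_j²)/(2·h·r_k)). -/
open MeasureTheory Metric Real

/-- Area of the circular segment cut from a disk of radius `r` at signed distance `c` from its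
center, as an integral of chord lengths. -/
lemma integral_two_mul_sqrt_sq_sub_sq {r c : ℝ} (hr : 0 < r) (hc : -r ≤ c) (hcr : c ≤ r) :
    ∫ s in c..r, 2 * √(r ^ 2 - s ^ 2) = arccos (c / r) * r ^ 2 - c * √(r ^ 2 - c ^ 2) := by
  have hcont : Continuous fun s : ℝ => 2 * √(r ^ 2 - s ^ 2) := by fun_prop
  have hderiv : ∀ s ∈ Set.Ioo c r,
      HasDerivAt (fun s => s * √(r ^ 2 - s ^ 2) - arccos (s / r) * r ^ 2)
        (2 * √(r ^ 2 - s ^ 2)) s := by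
    rintro s ⟨hs₁, hs₂⟩
    have hpos : 0 < r ^ 2 - s ^ 2 := by nlinarith
    have hsqrt : √(1 - (s / r) ^ 2) = √(r ^ 2 - s ^ 2) / r := by
      rw [show 1 - (s / r) ^ 2 = (r ^ 2 - s ^ 2) / r ^ 2 by field_simp, sqrt_div hpos.le,
        sqrt_sq hr.le]
    have hne : √(r ^ 2 - s ^ 2) ≠ 0 := (sqrt_pos.2 hpos).ne'
    have hroot : HasDerivAt (fun s : ℝ => √(r ^ 2 - s ^ 2))
        (-(2 * s) / (2 * √(r ^ 2 - s ^ 2))) s := by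
      have h := ((hasDerivAt_pow 2 s).const_sub (r ^ 2)).sqrt hpos.ne'
      simpa using h
    have harccos : HasDerivAt (fun s : ℝ => arccos (s / r))
        (-(1 / √(1 - (s / r) ^ 2)) * (1 / r)) s := by
      refine (hasDerivAt_arccos ?_ ?_).comp s ((hasDerivAt_id s).div_const r)
      · rw [ne_eq, div_eq_iff hr.ne']; linarith
      · rw [ne_eq, div_eq_iff hr.ne']; linarith
    refine (((hasDerivAt_id s).mul hroot).sub (harccos.mul_const (r ^ 2))).congr_deriv ?_
    rw [hsqrt]
    have hsq := sq_sqrt hpos.le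
    simp only [id]
    field_simp
    linarith
  rw [intervalIntegral.integral_eq_sub_of_hasDerivAt_of_le hcr (by fun_prop) hderiv
    (hcont.intervalIntegrable _ _)]
  simp [hr.ne']

/-- Area of the intersection of two disks centered on the first axis, as an integral of the
lengths of vertical chords. -/
lemma volume_toReal_inter_disks_eq_integral (r s h : ℝ) :
    (volume {p : ℝ × ℝ | p.1 ^ 2 + p.2 ^ 2 ≤ r ^ 2 ∧ (p.1 - h) ^ 2 + p.2 ^ 2 ≤ s ^ 2}).toReal =
      ∫ u, 2 * √(min (r ^ 2 - u ^ 2) (s ^ 2 - (u - h) ^ 2)) := by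
  have hmeas : MeasurableSet
      {p : ℝ × ℝ | p.1 ^ 2 + p.2 ^ 2 ≤ r ^ 2 ∧ (p.1 - h) ^ 2 + p.2 ^ 2 ≤ s ^ 2} := by
    measurability
  have hcont : Continuous fun u : ℝ => 2 * √(min (r ^ 2 - u ^ 2) (s ^ 2 - (u - h) ^ 2)) := by
    fun_prop
  rw [Measure.volume_eq_prod, Measure.prod_apply hmeas,
    integral_eq_lintegral_of_nonneg_ae (.of_forall fun u => by positivity)
      hcont.aestronglyMeasurable]
  congr 2 with u
  set m := min (r ^ 2 - u ^ 2) (s ^ 2 - (u - h) ^ 2) with hm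
  have hsec : Prod.mk u ⁻¹'
      {p : ℝ × ℝ | p.1 ^ 2 + p.2 ^ 2 ≤ r ^ 2 ∧ (p.1 - h) ^ 2 + p.2 ^ 2 ≤ s ^ 2} =
      {v : ℝ | v ^ 2 ≤ m} := by
    ext v
    simp only [Set.mem_preimage, Set.mem_ofPred_eq, hm, le_min_iff]
    constructor <;> rintro ⟨h₁, h₂⟩ <;> constructor <;> linarith
  rw [hsec]
  rcases lt_or_ge m 0 with hneg | hnonneg
  · have hempty : {v : ℝ | v ^ 2 ≤ m} = ∅ := by
      ext v
      simpa using hneg.trans_le (sq_nonneg v)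
    simp [hempty, sqrt_eq_zero_of_nonpos hneg.le]
  · have hIcc : {v : ℝ | v ^ 2 ≤ m} = Set.Icc (-√m) (√m) := by
      ext v
      simp [Real.sq_le hnonneg]
    rw [hIcc, Real.volume_Icc]
    congr 1
    ring

/-- In the plane, two disks centered at `0` and `x` can be rotated so that `x` lies on the first
axis. -/
lemma volume_closedBall_inter_closedBall {r s : ℝ} (hr : 0 ≤ r) (hs : 0 ≤ s)
    (x : EuclideanSpace ℝ (Fin 2)) (hx : x ≠ 0) :
    volume (closedBall (0 : EuclideanSpace ℝ (Fin 2)) r ∩ closedBall x s) =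
      volume {p : ℝ × ℝ | p.1 ^ 2 + p.2 ^ 2 ≤ r ^ 2 ∧ (p.1 - ‖x‖) ^ 2 + p.2 ^ 2 ≤ s ^ 2} := by
  let b := Complex.orthonormalBasisOneI.repr
  let w : ℂ := b.symm x
  have hw : ‖w‖ = ‖x‖ := b.symm.norm_map x
  have hnorm : (‖x‖ : ℂ) ≠ 0 := by simpa using hx
  have hunit : ‖w / ‖x‖‖ = 1 := by
    rw [norm_div, hw, Complex.norm_real, norm_norm, div_self (norm_ne_zero_iff.2 hx)]
  let a : Circle := ⟨w / ‖x‖, by simpa [Submonoid.unitSphere] using hunit⟩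
  let e : ℂ ≃ₗᵢ[ℝ] EuclideanSpace ℝ (Fin 2) := (rotation a).trans b
  have he : e (‖x‖ : ℂ) = x := by
    change b (w / ‖x‖ * ‖x‖) = x
    rw [div_mul_cancel₀ _ hnorm]
    exact b.apply_symm_apply x
  have hmeas : MeasurableSet (closedBall (0 : EuclideanSpace ℝ (Fin 2)) r ∩ closedBall x s) :=
    measurableSet_closedBall.inter measurableSet_closedBall
  have hpres : MeasurePreserving e := e.measurePreserving
  rw [← hpres.measure_preimage hmeas.nullMeasurableSet,
    ← Complex.volume_preserving_equiv_real_prod.symm.measure_preimage_equiv]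
  congr 1
  ext p
  have hdist : dist (e (Complex.measurableEquivRealProd.symm p)) x =
      dist (Complex.measurableEquivRealProd.symm p) (‖x‖ : ℂ) := by
    conv_lhs => rw [← he]
    exact e.dist_map _ _
  simp only [Set.mem_preimage, Set.mem_inter_iff, mem_closedBall, hdist, dist_zero_right,
    e.norm_map, Set.mem_ofPred_eq, Complex.dist_eq]
  rw [← sq_le_sq₀ (norm_nonneg _) hr, ← sq_le_sq₀ (norm_nonneg _) hs, Complex.sq_norm,
    Complex.sq_norm, Complex.normSq_apply, Complex.normSq_apply]
  simp [Complex.measurableEquivRealProd_symm_apply, sq]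

/-- Area of the intersection of two closed disks in the Euclidean plane:
for `0 < r_j ≤ r_k`, `‖x‖ = h` with `h > 0` and `r_k − r_j ≤ h ≤ r_k + r_j`, the area of
`B̄(0, r_k) ∩ B̄(x, r_j)` equals `φ₁ r_j² + θ₁ r_k² − h r_j sin φ₁`, where
`φ₁ = arccos((h² + r_j² − r_k²)/(2 h r_j))` and `θ₁ = arccos((h² + r_k² − r_j²)/(2 h r_k))`. -/
theorem disk_intersection_area (rj rk h : ℝ) (hrj : 0 < rj) (hjk : rj ≤ rk)
    (x : EuclideanSpace ℝ (Fin 2)) (hx : ‖x‖ = h) (hh : 0 < h)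
    (hlow : rk - rj ≤ h) (hhigh : h ≤ rk + rj) :
    (volume (closedBall (0 : EuclideanSpace ℝ (Fin 2)) rk ∩ closedBall x rj)).toReal =
      Real.arccos ((h ^ 2 + rj ^ 2 - rk ^ 2) / (2 * h * rj)) * rj ^ 2
        + Real.arccos ((h ^ 2 + rk ^ 2 - rj ^ 2) / (2 * h * rk)) * rk ^ 2
        - h * rj * Real.sin (Real.arccos ((h ^ 2 + rj ^ 2 - rk ^ 2) / (2 * h * rj))) := by
  have hrk : 0 < rk := hrj.trans_le hjk
  have hx0 : x ≠ 0 := norm_pos_iff.1 (hx ▸ hh)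
  rw [volume_closedBall_inter_closedBall hrk.le hrj.le x hx0, hx,
    volume_toReal_inter_disks_eq_integral]
  -- `a` is the abscissa of the common chord
  obtain ⟨a, ha⟩ : ∃ a, a = (h ^ 2 + rk ^ 2 - rj ^ 2) / (2 * h) := ⟨_, rfl⟩
  have ha' : 2 * h * a = h ^ 2 + rk ^ 2 - rj ^ 2 := by rw [ha]; field_simp
  have hb : h - a = (h ^ 2 + rj ^ 2 - rk ^ 2) / (2 * h) := by rw [ha]; field_simp; ring
  have h₁ : h - rj ≤ a := by
    refine le_of_mul_le_mul_left ?_ (by positivity : 0 < 2 * h)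
    nlinarith
  have h₂ : a ≤ h + rj := by
    refine le_of_mul_le_mul_left ?_ (by positivity : 0 < 2 * h)
    nlinarith
  have h₃ : a ≤ rk := by
    refine le_of_mul_le_mul_left ?_ (by positivity : 0 < 2 * h)
    nlinarith
  have h₄ : -rk ≤ a := by
    refine le_of_mul_le_mul_left ?_ (by positivity : 0 < 2 * h)
    nlinarith
  have hchord : rk ^ 2 - a ^ 2 = rj ^ 2 - (h - a) ^ 2 := by linarith
  have hcont : Continuous fun u : ℝ =>
      2 * √(min (rk ^ 2 - u ^ 2) (rj ^ 2 - (u - h) ^ 2)) := by fun_prop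
  have hsupp : ∀ u, u ∉ Set.Ioc (h - rj) rk →
      2 * √(min (rk ^ 2 - u ^ 2) (rj ^ 2 - (u - h) ^ 2)) = 0 := by
    intro u hu
    rw [sqrt_eq_zero_of_nonpos, mul_zero]
    rcases le_or_gt u (h - rj) with hle | hgt
    · exact (min_le_right _ _).trans (by nlinarith)
    · have hlt : rk < u := not_le.1 fun hle => hu ⟨hgt, hle⟩
      exact (min_le_left _ _).trans (by nlinarith)
  have hleft : ∫ u in (h - rj)..a, 2 * √(min (rk ^ 2 - u ^ 2) (rj ^ 2 - (u - h) ^ 2)) =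
      arccos ((h - a) / rj) * rj ^ 2 - (h - a) * √(rj ^ 2 - (h - a) ^ 2) := by
    rw [← integral_two_mul_sqrt_sq_sub_sq hrj (by linarith) (by linarith)]
    have hsub := intervalIntegral.integral_comp_sub_left
      (fun s => 2 * √(rj ^ 2 - s ^ 2)) (a := h - rj) (b := a) h
    rw [sub_sub_cancel] at hsub
    rw [← hsub]
    refine intervalIntegral.integral_congr fun u hu => ?_
    rw [Set.uIcc_of_le h₁] at hu
    rw [min_eq_right (by nlinarith [mul_le_mul_of_nonneg_left hu.2 hh.le])]
    congr 3
    ring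
  have hright : ∫ u in a..rk, 2 * √(min (rk ^ 2 - u ^ 2) (rj ^ 2 - (u - h) ^ 2)) =
      arccos (a / rk) * rk ^ 2 - a * √(rk ^ 2 - a ^ 2) := by
    rw [← integral_two_mul_sqrt_sq_sub_sq hrk h₄ h₃]
    refine intervalIntegral.integral_congr fun u hu => ?_
    rw [Set.uIcc_of_le h₃] at hu
    rw [min_eq_left (by nlinarith [mul_le_mul_of_nonneg_left hu.1 hh.le])]
  have hsin : rj * sin (arccos ((h - a) / rj)) = √(rj ^ 2 - (h - a) ^ 2) := by
    rw [sin_arccos, show rj ^ 2 - (h - a) ^ 2 = rj ^ 2 * (1 - ((h - a) / rj) ^ 2) by field_simp,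
      sqrt_mul (sq_nonneg rj), sqrt_sq hrj.le]
  rw [← setIntegral_eq_integral_of_forall_compl_eq_zero hsupp,
    ← intervalIntegral.integral_of_le (h₁.trans h₃),
    ← intervalIntegral.integral_add_adjacent_intervals (hcont.intervalIntegrable _ a)
      (hcont.intervalIntegrable a _), hleft, hright, hchord, ← div_div _ (2 * h) rj,
    ← div_div _ (2 * h) rk, ← hb, ← ha,
    mul_assoc h, hsin]
  ring
end

section
/- For every r > 0, the measure (with respect to the product of 2-dimensional Lebesgue measures) of the set {(x, y) ∈ B̄(0,r) × B̄(0,r) : dist(x,y) ≤ r} equals (1 − 3√3/(4π))·π²·r⁴. Equivalently, two independent points distributed uniformly on a disk of radius r are within distance r of each other with probability exactly C = 1 − 3√3/(4π) (the cluster coefficient of a planar random geometric graph with identical radii). -/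
open MeasureTheory Metric Real

theorem integral_sqrt_one_sub_sq_symm {h : ℝ} (h0 : 0 ≤ h) (h1 : h ≤ 1) :
    ∫ b in (-h)..h, √(1 - b ^ 2) = arcsin h + h * √(1 - h ^ 2) := by
  have key := intervalIntegral.integral_eq_sub_of_hasDerivAt_of_le (a := -h) (b := h)
    (f := fun b ↦ (arcsin b + b * √(1 - b ^ 2)) / 2) (f' := fun b ↦ √(1 - b ^ 2))
    (by linarith) (by fun_prop) ?_ (Continuous.intervalIntegrable (by fun_prop) _ _)
  · rw [key, arcsin_neg]
    ring_nf
  · rintro b ⟨hb, hb'⟩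
    have hpos : 0 < 1 - b ^ 2 := by nlinarith
    have hs : √(1 - b ^ 2) ≠ 0 := (sqrt_pos.2 hpos).ne'
    have hsq := sq_sqrt hpos.le
    have hd : HasDerivAt (fun b : ℝ ↦ 1 - b ^ 2) (-(2 * b)) b := by
      simpa using (hasDerivAt_pow 2 b).const_sub 1
    refine (((hasDerivAt_arcsin (x := b) (by linarith) (by linarith)).fun_add
      ((hasDerivAt_id' b).fun_mul (hd.sqrt hpos.ne'))).div_const 2).congr_deriv ?_
    field_simp
    rw [hsq]
    ring

/-- The area of the intersection of two unit disks whose centers are at distance `d ≤ 2`. -/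
noncomputable def lensArea (d : ℝ) : ℝ := π - 2 * arcsin (d / 2) - d * √(1 - (d / 2) ^ 2)

theorem integral_lens_chord {d : ℝ} (h0 : 0 ≤ d) (h2 : d ≤ 2) :
    ∫ b in (-√(1 - (d / 2) ^ 2))..√(1 - (d / 2) ^ 2), (2 * √(1 - b ^ 2) - d) = lensArea d := by
  have hh : √(1 - (d / 2) ^ 2) ≤ 1 := by
    rw [sqrt_le_one]
    nlinarith [sq_nonneg d]
  have hs : √(1 - √(1 - (d / 2) ^ 2) ^ 2) = d / 2 := by
    rw [sq_sqrt (by nlinarith), sub_sub_cancel, sqrt_sq (by linarith)]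
  rw [intervalIntegral.integral_sub (Continuous.intervalIntegrable (by fun_prop) _ _)
      (by simp), intervalIntegral.integral_const_mul,
    integral_sqrt_one_sub_sq_symm (sqrt_nonneg _) hh, hs,
    ← arccos_eq_arcsin (by linarith), arccos, intervalIntegral.integral_const, lensArea, smul_eq_mul]
  ring

theorem lens_chord_nonneg {d a : ℝ} (h0 : 0 ≤ d) (h2 : d ≤ 2)
    (ha : a ∈ Set.Icc (-√(1 - (d / 2) ^ 2)) √(1 - (d / 2) ^ 2)) : 0 ≤ 2 * √(1 - a ^ 2) - d := by
  have hsq : √(1 - (d / 2) ^ 2) ^ 2 = 1 - (d / 2) ^ 2 := sq_sqrt (by nlinarith)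
  have : d / 2 ≤ √(1 - a ^ 2) := by
    apply le_sqrt_of_sq_le
    nlinarith [ha.1, ha.2]
  linarith

theorem lensArea_nonneg {d : ℝ} (h0 : 0 ≤ d) (h2 : d ≤ 2) : 0 ≤ lensArea d := by
  rw [← integral_lens_chord h0 h2]
  exact intervalIntegral.integral_nonneg (neg_le_self (sqrt_nonneg _))
    fun a ha ↦ lens_chord_nonneg h0 h2 ha

theorem volume_real_prod_lens {d : ℝ} (h0 : 0 ≤ d) (h2 : d ≤ 2) :
    volume {p : ℝ × ℝ | p.1 ^ 2 + p.2 ^ 2 ≤ 1 ∧ p.1 ^ 2 + (p.2 - d) ^ 2 ≤ 1} =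
      ENNReal.ofReal (lensArea d) := by
  set h := √(1 - (d / 2) ^ 2) with hh
  have hsq : h ^ 2 = 1 - (d / 2) ^ 2 := sq_sqrt (by nlinarith)
  have hh0 : 0 ≤ h := sqrt_nonneg _
  have hmeas : MeasurableSet
      {p : ℝ × ℝ | p.1 ^ 2 + p.2 ^ 2 ≤ 1 ∧ p.1 ^ 2 + (p.2 - d) ^ 2 ≤ 1} :=
    ((isClosed_le (by fun_prop) (by fun_prop)).and
      (isClosed_le (by fun_prop) (by fun_prop))).measurableSet
  have hslice (a : ℝ) : volume (Prod.mk a ⁻¹'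
      {p : ℝ × ℝ | p.1 ^ 2 + p.2 ^ 2 ≤ 1 ∧ p.1 ^ 2 + (p.2 - d) ^ 2 ≤ 1}) =
      ENNReal.ofReal (2 * √(1 - a ^ 2) - d) := by
    rcases le_or_gt 0 (1 - a ^ 2) with ha | ha
    · have : Prod.mk a ⁻¹' {p : ℝ × ℝ | p.1 ^ 2 + p.2 ^ 2 ≤ 1 ∧ p.1 ^ 2 + (p.2 - d) ^ 2 ≤ 1} =
          Set.Icc (d - √(1 - a ^ 2)) √(1 - a ^ 2) := by
        ext b
        have e1 : a ^ 2 + b ^ 2 ≤ 1 ↔ |b| ≤ √(1 - a ^ 2) := by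
          rw [le_sqrt (abs_nonneg _) ha, sq_abs, le_sub_iff_add_le']
        have e2 : a ^ 2 + (b - d) ^ 2 ≤ 1 ↔ |b - d| ≤ √(1 - a ^ 2) := by
          rw [le_sqrt (abs_nonneg _) ha, sq_abs, le_sub_iff_add_le']
        simp only [Set.mem_preimage, Set.mem_ofPred_eq, Set.mem_Icc, e1, e2, abs_le]
        constructor
        · rintro ⟨⟨_, _⟩, _, _⟩
          constructor <;> linarith
        · rintro ⟨_, _⟩
          refine ⟨⟨?_, ?_⟩, ?_, ?_⟩ <;> linarith
      rw [this, Real.volume_Icc]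
      congr 1
      ring
    · have : Prod.mk a ⁻¹' {p : ℝ × ℝ | p.1 ^ 2 + p.2 ^ 2 ≤ 1 ∧ p.1 ^ 2 + (p.2 - d) ^ 2 ≤ 1} =
          ∅ := by
        ext b
        simp only [Set.mem_preimage, Set.mem_ofPred_eq, Set.mem_empty_iff_false, iff_false, not_and]
        intro hb
        nlinarith [sq_nonneg b]
      rw [this, measure_empty, sqrt_eq_zero_of_nonpos ha.le, ENNReal.ofReal_of_nonpos (by linarith)]
  have hsupp : Function.support (fun a : ℝ ↦ ENNReal.ofReal (2 * √(1 - a ^ 2) - d)) ⊆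
      Set.Ioc (-h) h := by
    intro a ha
    have ha' : d / 2 < √(1 - a ^ 2) := by
      have := (ENNReal.ofReal_pos.1 (pos_iff_ne_zero.2 ha))
      linarith
    rw [lt_sqrt (by linarith)] at ha'
    have := abs_lt_of_sq_lt_sq (a := a) (b := h) (by linarith) hh0
    exact ⟨(abs_lt.1 this).1, (abs_lt.1 this).2.le⟩
  rw [Measure.volume_eq_prod, Measure.prod_apply hmeas]
  simp_rw [hslice]
  rw [← setLIntegral_eq_of_support_subset hsupp,
    ← ofReal_integral_eq_lintegral_ofReal, ← intervalIntegral.integral_of_le (by linarith),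
    integral_lens_chord h0 h2]
  · exact (Continuous.intervalIntegrable (by fun_prop) (-h) h).1
  · exact (ae_restrict_iff' measurableSet_Ioc).2 (Filter.Eventually.of_forall
      fun a ha ↦ lens_chord_nonneg h0 h2 (Set.Ioc_subset_Icc_self ha))

theorem exists_linearIsometryEquiv_complex_apply_norm_mul_I (x : EuclideanSpace ℝ (Fin 2)) :
    ∃ e : ℂ ≃ₗᵢ[ℝ] EuclideanSpace ℝ (Fin 2), e (‖x‖ * Complex.I) = x := by
  set φ := Complex.orthonormalBasisOneI.repr
  refine ⟨(rotation (Circle.exp (Complex.arg (φ.symm x) - π / 2))).trans φ, ?_⟩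
  rw [LinearIsometryEquiv.trans_apply, ← LinearIsometryEquiv.eq_symm_apply, rotation_apply,
    Circle.coe_exp]
  push_cast
  rw [sub_mul, Complex.exp_sub, Complex.exp_pi_div_two_mul_I]
  have hpolar := Complex.norm_mul_exp_arg_mul_I (φ.symm x)
  rw [LinearIsometryEquiv.norm_map] at hpolar
  conv_rhs => rw [← hpolar]
  field_simp

theorem volume_closedBall_inter_closedBall_one {x : EuclideanSpace ℝ (Fin 2)} (hx : ‖x‖ ≤ 2) :
    volume (closedBall 0 1 ∩ closedBall x 1) = ENNReal.ofReal (lensArea ‖x‖) := by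
  obtain ⟨e, he⟩ := exists_linearIsometryEquiv_complex_apply_norm_mul_I x
  have hpre : e ⁻¹' (closedBall 0 1 ∩ closedBall x 1) =
      Complex.measurableEquivRealProd ⁻¹'
        {p : ℝ × ℝ | p.1 ^ 2 + p.2 ^ 2 ≤ 1 ∧ p.1 ^ 2 + (p.2 - ‖x‖) ^ 2 ≤ 1} := by
    ext z
    have e1 : dist (e z) x = ‖z - ‖x‖ * Complex.I‖ := by
      conv_lhs => rw [← he, LinearIsometryEquiv.dist_map, dist_eq_norm]
    simp only [Set.mem_preimage, Set.mem_inter_iff, mem_closedBall, e1]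
    simp [Complex.norm_eq_sqrt_sq_add_sq, Complex.measurableEquivRealProd_apply]
  rw [← volume_real_prod_lens (norm_nonneg x) hx,
    ← Complex.volume_preserving_equiv_real_prod.measure_preimage_equiv, ← hpre]
  exact (e.measurePreserving.measure_preimage_equiv (f := e.toMeasurableEquiv) _).symm

theorem integral_mul_lensArea :
    ∫ t in (0 : ℝ)..1, t * lensArea t = π / 2 - 3 * √3 / 8 := by
  have harc : arcsin (1 / 2) = π / 6 :=
    arcsin_eq_of_sin_eq sin_pi_div_six ⟨by linarith [pi_pos], by linarith [pi_pos]⟩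
  have hsqrt : √(1 - (1 / 2 : ℝ) ^ 2) = √3 / 2 := by
    rw [show (1 - (1 / 2) ^ 2 : ℝ) = 3 / 2 ^ 2 by norm_num, sqrt_div (by norm_num),
      sqrt_sq (by norm_num)]
  have key := intervalIntegral.integral_eq_sub_of_hasDerivAt (a := 0) (b := 1)
    (f := fun t ↦ t ^ 2 * (π / 2 - arcsin (t / 2)) + arcsin (t / 2) +
      t * √(1 - (t / 2) ^ 2) * (-1 / 2 - t ^ 2 / 4)) (f' := fun t ↦ t * lensArea t)
    ?_ (Continuous.intervalIntegrable (by unfold lensArea; fun_prop) _ _)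
  · rw [key, harc, hsqrt]
    simp
    ring
  · intro t ht
    rw [Set.uIcc_of_le zero_le_one] at ht
    obtain ⟨ht0, ht1⟩ := ht
    have hpos : 0 < 1 - (t / 2) ^ 2 := by nlinarith
    have hs : √(1 - (t / 2) ^ 2) ≠ 0 := (sqrt_pos.2 hpos).ne'
    have hsq := sq_sqrt hpos.le
    have hid : HasDerivAt (fun t : ℝ ↦ t) 1 t := hasDerivAt_id' t
    have hhalf : HasDerivAt (fun t : ℝ ↦ t / 2) (1 / 2) t := hid.div_const 2
    have ha := (hasDerivAt_arcsin (x := t / 2) (by linarith) (by linarith)).comp t hhalf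
    have hr := ((hhalf.fun_pow 2).const_sub 1).sqrt hpos.ne'
    refine ((((hid.fun_pow 2).fun_mul (ha.const_sub (π / 2))).fun_add ha).fun_add
      ((hid.fun_mul hr).fun_mul
        (((hid.fun_pow 2).div_const 4).const_sub (-1 / 2)))).congr_deriv ?_
    simp only [lensArea, Function.comp_apply]
    generalize √(1 - (t / 2) ^ 2) = s at hs hsq ⊢
    field_simp
    linear_combination (8 * t ^ 2 - 16) * hsq

theorem volume_real_unit_cluster :
    volume.real {p : EuclideanSpace ℝ (Fin 2) × EuclideanSpace ℝ (Fin 2) |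
        p.1 ∈ closedBall (0 : EuclideanSpace ℝ (Fin 2)) 1 ∧
        p.2 ∈ closedBall (0 : EuclideanSpace ℝ (Fin 2)) 1 ∧
        dist p.1 p.2 ≤ 1} = 2 * π * (π / 2 - 3 * √3 / 8) := by
  set S := {p : EuclideanSpace ℝ (Fin 2) × EuclideanSpace ℝ (Fin 2) |
        p.1 ∈ closedBall (0 : EuclideanSpace ℝ (Fin 2)) 1 ∧
        p.2 ∈ closedBall (0 : EuclideanSpace ℝ (Fin 2)) 1 ∧
        dist p.1 p.2 ≤ 1} with hS
  have hmeas : MeasurableSet S := by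
    simp only [hS, mem_closedBall]
    exact ((isClosed_le (by fun_prop) (by fun_prop)).and ((isClosed_le (by fun_prop)
      (by fun_prop)).and (isClosed_le (by fun_prop) (by fun_prop)))).measurableSet
  have hslice (x : EuclideanSpace ℝ (Fin 2)) : (volume (Prod.mk x ⁻¹' S)).toReal =
      (Set.Iic (1 : ℝ)).indicator (fun d ↦ lensArea d) ‖x‖ := by
    by_cases hx : ‖x‖ ≤ 1
    · have : Prod.mk x ⁻¹' S = closedBall 0 1 ∩ closedBall x 1 := by
        ext y
        simp [hS, hx, dist_comm x y]
      rw [this, volume_closedBall_inter_closedBall_one (by linarith),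
        Set.indicator_of_mem (by exact hx), ENNReal.toReal_ofReal
          (lensArea_nonneg (norm_nonneg x) (by linarith))]
    · have : Prod.mk x ⁻¹' S = ∅ := by
        ext y
        simp [hS, hx]
      rw [this, Set.indicator_of_notMem (by exact hx)]
      simp
  have hfin (x : EuclideanSpace ℝ (Fin 2)) : volume (Prod.mk x ⁻¹' S) < ⊤ :=
    (measure_mono fun y hy ↦ hy.2.1).trans_lt
      (measure_closedBall_lt_top (x := (0 : EuclideanSpace ℝ (Fin 2))) (r := 1))
  rw [Measure.real, Measure.volume_eq_prod, Measure.prod_apply hmeas,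
    ← integral_toReal (measurable_measure_prodMk_left hmeas).aemeasurable
      (Filter.Eventually.of_forall hfin)]
  simp_rw [hslice]
  rw [integral_fun_norm_addHaar volume, Measure.real, EuclideanSpace.volume_ball_fin_two,
    ← integral_mul_lensArea, intervalIntegral.integral_of_le zero_le_one]
  have : ∫ y in Set.Ioi (0 : ℝ), y ^ (Module.finrank ℝ (EuclideanSpace ℝ (Fin 2)) - 1) •
      (Set.Iic (1 : ℝ)).indicator (fun d ↦ lensArea d) y =
      ∫ t in Set.Ioc (0 : ℝ) 1, t * lensArea t := by
    rw [← Set.Ioi_inter_Iic, ← setIntegral_indicator measurableSet_Iic]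
    congr with y
    by_cases hy : y ≤ 1 <;> simp [hy]
  rw [this]
  simp [pi_nonneg]
  ring

/-- Two independent uniform points in a disk of radius `r` are within
distance `r` of each other with probability `C = 1 − 3√3/(4π)`: the product-Lebesgue measure
of `{(x, y) ∈ B̄(0,r) × B̄(0,r) : dist x y ≤ r}` equals `(1 − 3√3/(4π)) π² r⁴`. -/
theorem cluster_coefficient_rgg (r : ℝ) (hr : 0 < r) :
    (volume {p : EuclideanSpace ℝ (Fin 2) × EuclideanSpace ℝ (Fin 2) |
        p.1 ∈ closedBall (0 : EuclideanSpace ℝ (Fin 2)) r ∧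
        p.2 ∈ closedBall (0 : EuclideanSpace ℝ (Fin 2)) r ∧
        dist p.1 p.2 ≤ r}).toReal =
      (1 - 3 * Real.sqrt 3 / (4 * Real.pi)) * Real.pi ^ 2 * r ^ 4 := by
  have hscale : {p : EuclideanSpace ℝ (Fin 2) × EuclideanSpace ℝ (Fin 2) |
        p.1 ∈ closedBall (0 : EuclideanSpace ℝ (Fin 2)) r ∧
        p.2 ∈ closedBall (0 : EuclideanSpace ℝ (Fin 2)) r ∧
        dist p.1 p.2 ≤ r} = (r⁻¹ • · ) ⁻¹'
      {p : EuclideanSpace ℝ (Fin 2) × EuclideanSpace ℝ (Fin 2) |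
        p.1 ∈ closedBall (0 : EuclideanSpace ℝ (Fin 2)) 1 ∧
        p.2 ∈ closedBall (0 : EuclideanSpace ℝ (Fin 2)) 1 ∧
        dist p.1 p.2 ≤ 1} := by
    ext p
    simp [dist_smul₀, norm_smul, abs_of_pos hr, inv_mul_le_iff₀ hr]
  have hunit := volume_real_unit_cluster
  rw [Measure.real] at hunit
  have : (volume : Measure (EuclideanSpace ℝ (Fin 2) × EuclideanSpace ℝ (Fin 2))).IsAddHaarMeasure :=
    inferInstanceAs (Measure.prod volume volume).IsAddHaarMeasure
  rw [hscale, Measure.addHaar_preimage_smul volume (inv_pos.2 hr).ne', ENNReal.toReal_mul, hunit,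
    ENNReal.toReal_ofReal (abs_nonneg _), Module.finrank_prod, finrank_euclideanSpace_fin,
    inv_pow, inv_inv, abs_of_pos (by positivity)]
  field_simp
  ring
end
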